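/- Strict decrease of the part metric (nonlocal dispersal case). Assume f satisfies (H0). For all ε > 0, σ > 0, M > 0 and τ > 0 with ε < M and σ ≤ log(M/ε), there exists δ > 0 with the following property: whenever u and v are solutions of (E_f) on [0,τ] with ε ≤ u(0,x) ≤ M and ε ≤ v(0,x) ≤ M for all x, and ρ(u(0,·), v(0,·)) ≥ σ, then inf_x u(τ,x) > 0, inf_x v(τ,x) > 0, and ρ(u(τ,·), v(τ,·)) ≤ ρ(u(0,·), v(0,·)) − δ. -/

import Mathlib

open MeasureTheory Set Filter RealInnerProductSpace

noncomputable section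

abbrev Euc (N : ℕ) := EuclideanSpace ℝ (Fin N)

/-- Membership in `X`: bounded and uniformly continuous real functions on `ℝ^N`. -/
def MemX {N : ℕ} (u : Euc N → ℝ) : Prop :=
  UniformContinuous u ∧ ∃ C, ∀ x, |u x| ≤ C

/-- Hypotheses on the convolution kernel `κ`. -/
def KernelHyp {N : ℕ} (κ : Euc N → ℝ) : Prop :=
  Continuous κ ∧ (∀ z, 0 ≤ κ z) ∧ HasCompactSupport κ ∧ 0 < κ 0 ∧ (∫ z, κ z) = 1

/-- Hypothesis (H0) on the nonlinearity `f`. -/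
def SatH0 {N : ℕ} (T M₀ : ℝ) (f : ℝ → Euc N → ℝ → ℝ) : Prop :=
  (∀ t x u, f (t + T) x u = f t x u) ∧
  (∀ x : Euc N, ContDiff ℝ 1 (fun p : ℝ × ℝ => f p.1 x p.2)) ∧
  (∀ R : ℝ, 0 < R →
    (∃ C, ∀ t x u, |u| ≤ R →
      |f t x u| + |deriv (fun s => f s x u) t| + |deriv (fun v => f t x v) u| ≤ C) ∧
    UniformContinuousOn (fun p : ℝ × Euc N × ℝ => f p.1 p.2.1 p.2.2)
      {p : ℝ × Euc N × ℝ | |p.2.2| ≤ R} ∧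
    UniformContinuousOn (fun p : ℝ × Euc N × ℝ => deriv (fun s => f s p.2.1 p.2.2) p.1)
      {p : ℝ × Euc N × ℝ | |p.2.2| ≤ R} ∧
    UniformContinuousOn (fun p : ℝ × Euc N × ℝ => deriv (fun v => f p.1 p.2.1 v) p.2.2)
      {p : ℝ × Euc N × ℝ | |p.2.2| ≤ R}) ∧
  (∀ t x u, M₀ ≤ u → f t x u < 0) ∧
  (∀ a b : ℝ, 0 ≤ a → a ≤ b → ∃ c < (0:ℝ), ∀ t x u, a ≤ u → u ≤ b →
    deriv (fun v => f t x v) u ≤ c)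

/-- Right-hand side of the nonlocal dispersal KPP equation (E_g). -/
def RHS {N : ℕ} (κ : Euc N → ℝ) (g : ℝ → Euc N → ℝ → ℝ)
    (u : ℝ → Euc N → ℝ) (t : ℝ) (x : Euc N) : ℝ :=
  (∫ y, κ (y - x) * u t y) - u t x + u t x * g t x (u t x)

/-- A solution of (E_g) on the interval `I`. -/
def IsSol {N : ℕ} (κ : Euc N → ℝ) (g : ℝ → Euc N → ℝ → ℝ)
    (u : ℝ → Euc N → ℝ) (I : Set ℝ) : Prop :=
  ContinuousOn (fun p : ℝ × Euc N => u p.1 p.2) (I ×ˢ univ) ∧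
  (∀ t ∈ I, MemX (u t)) ∧
  (∀ J : Set ℝ, J ⊆ I → IsCompact J → ∃ C, ∀ t ∈ J, ∀ x, |u t x| ≤ C) ∧
  (∀ x : Euc N, ∀ t ∈ interior I, HasDerivAt (fun s => u s x) (RHS κ g u t x) t)

/-- A time periodic strictly positive solution of (E_g). -/
def PeriodicPosSol {N : ℕ} (κ : Euc N → ℝ) (g : ℝ → Euc N → ℝ → ℝ) (T : ℝ)
    (u : ℝ → Euc N → ℝ) : Prop :=
  IsSol κ g u univ ∧ (∀ t x, u (t + T) x = u t x) ∧ ∃ δ > 0, ∀ t x, δ ≤ u t x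

/-- The part metric between two strictly positive bounded functions. -/
def PartMetric {N : ℕ} (u v : Euc N → ℝ) : ℝ :=
  sInf (Real.log '' {α : ℝ | 1 ≤ α ∧ ∀ x, u x / α ≤ v x ∧ v x ≤ α * u x})

/-- Hypothesis (H1): `f` is asymptotically (in space) equal to the time and space
periodic nonlinearity `f₀`. -/
def SatH1 {N : ℕ} (T M₀ : ℝ) (p : Fin N → ℝ) (f f₀ : ℝ → Euc N → ℝ → ℝ) : Prop :=
  SatH0 T M₀ f₀ ∧ (∀ i, 0 < p i) ∧
  (∀ i t x u, f₀ t (x + p i • EuclideanSpace.single i (1:ℝ)) u = f₀ t x u) ∧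
  (∀ R : ℝ, 0 < R → ∀ ε : ℝ, 0 < ε → ∃ ρ : ℝ, ∀ t x u, ρ ≤ ‖x‖ → |u| ≤ R →
    |f t x u - f₀ t x u| ≤ ε)

/-- A time and space periodic positive solution of (E_g) (period `T` in time and
periods `pᵢ` in the spatial coordinate directions). -/
def PeriodicMediaSol {N : ℕ} (κ : Euc N → ℝ) (g : ℝ → Euc N → ℝ → ℝ) (T : ℝ)
    (p : Fin N → ℝ) (u : ℝ → Euc N → ℝ) : Prop :=
  IsSol κ g u univ ∧ (∀ t x, u (t + T) x = u t x) ∧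
  (∀ i t x, u t (x + p i • EuclideanSpace.single i (1:ℝ)) = u t x) ∧
  (∀ t x, 0 < u t x)

/-- The class `X⁺(ξ)` of front-like nonnegative initial data in the direction `ξ`. -/
def XplusXi {N : ℕ} (ξ : Euc N) (u : Euc N → ℝ) : Prop :=
  MemX u ∧ (∀ x, 0 ≤ u x) ∧
  (∃ m > 0, ∃ r : ℝ, ∀ x, ⟪x, ξ⟫ ≤ r → m ≤ u x) ∧
  (∃ r₀ : ℝ, ∀ x, r₀ ≤ ⟪x, ξ⟫ → u x = 0)


lemma aux_barrier (g g' : ℝ → ℝ) (τ k : ℝ) (hk : 0 ≤ k)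
    (hc : ContinuousOn g (Icc 0 τ)) (h0 : 0 ≤ g 0)
    (hd : ∀ t ∈ Ioo 0 τ, HasDerivAt g (g' t) t)
    (hg : ∀ t ∈ Ioo 0 τ, g t < -k → 0 ≤ g' t) :
    ∀ t ∈ Icc 0 τ, -k ≤ g t := by
  intro t ht
  by_contra hlt
  push Not at hlt
  have hsub : Icc 0 t ⊆ Icc 0 τ := Icc_subset_Icc_right ht.2
  set S : Set ℝ := Icc 0 t ∩ g ⁻¹' (Ici (-k)) with hS
  have hScl : IsClosed S := (hc.mono hsub).preimage_isClosed_of_isClosed isClosed_Icc isClosed_Ici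
  have hScomp : IsCompact S := isCompact_Icc.of_isClosed_subset hScl inter_subset_left
  have h0S : (0:ℝ) ∈ S := ⟨⟨le_rfl, ht.1⟩, by simp only [mem_preimage, mem_Ici]; linarith⟩
  have hs := hScomp.sSup_mem ⟨0, h0S⟩
  set s := sSup S with hsdef
  have hup : ∀ r ∈ S, r ≤ s := fun r hr => le_csSup hScomp.bddAbove hr
  have hgs : -k ≤ g s := hs.2
  have hmono : MonotoneOn g (Icc s t) := by
    apply monotoneOn_of_deriv_nonneg (convex_Icc s t)
    · exact hc.mono (Icc_subset_Icc hs.1.1 ht.2)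
    · intro r hr
      rw [interior_Icc] at hr
      exact (hd r ⟨lt_of_le_of_lt hs.1.1 hr.1, lt_of_lt_of_le hr.2 ht.2⟩).differentiableAt.differentiableWithinAt
    · intro r hr
      rw [interior_Icc] at hr
      have hr' : r ∈ Ioo 0 τ := ⟨lt_of_le_of_lt hs.1.1 hr.1, lt_of_lt_of_le hr.2 ht.2⟩
      rw [(hd r hr').deriv]
      apply hg r hr'
      by_contra hcon
      push Not at hcon
      exact absurd (hup r ⟨⟨hr'.1.le, hr.2.le⟩, hcon⟩) (not_le.mpr hr.1)
  have := hmono ⟨le_rfl, hs.1.2⟩ ⟨hs.1.2, le_rfl⟩ hs.1.2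
  linarith

lemma aux_int {N : ℕ} {κ : Euc N → ℝ} (hκ : KernelHyp κ) (w : Euc N → ℝ) (hw : Continuous w)
    (x : Euc N) : Integrable (fun y => κ (y - x) * w y) := by
  have hc : Continuous (fun y => κ (y - x)) := hκ.1.comp (continuous_id.sub continuous_const)
  apply (hc.mul hw).integrable_of_hasCompactSupport
  have : HasCompactSupport (fun y => κ (y - x)) := by
    have := hκ.2.2.1.comp_homeomorph (Homeomorph.subRight x)
    exact this
  exact this.mul_right

lemma aux_const {N : ℕ} {κ : Euc N → ℝ} (hκ : KernelHyp κ) (c : ℝ)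
    (x : Euc N) : ∫ y, κ (y - x) * c = c := by
  rw [integral_mul_const, integral_sub_right_eq_self κ x, hκ.2.2.2.2, one_mul]

lemma aux_comp {N : ℕ} {κ : Euc N → ℝ} (hκ : KernelHyp κ) (w wt : ℝ → Euc N → ℝ)
    (τ C B : ℝ)
    (hcont : ∀ x, ContinuousOn (fun t => w t x) (Icc 0 τ))
    (hx : ∀ t ∈ Icc 0 τ, Continuous (w t))
    (hB : ∀ t ∈ Icc 0 τ, ∀ x, |w t x| ≤ B)
    (hd : ∀ x, ∀ t ∈ Ioo 0 τ, HasDerivAt (fun s => w s x) (wt t x) t)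
    (h0 : ∀ x, 0 ≤ w 0 x)
    (hineq : ∀ t ∈ Ioo 0 τ, ∀ x, w t x < 0 → (∫ y, κ (y - x) * w t y) + C * w t x ≤ wt t x) :
    ∀ t ∈ Icc 0 τ, ∀ x, 0 ≤ w t x := by
  set l : ℝ := |C| + 2 with hl
  have hCl : C - l ≤ -2 := by have := le_abs_self C; linarith
  have hl0 : 0 < l := by have := abs_nonneg C; linarith
  set W : ℝ → Euc N → ℝ := fun t x => Real.exp (-l * t) * w t x with hW
  have step : ∀ m : ℝ, 0 ≤ m → (∀ t ∈ Icc 0 τ, ∀ x, -m ≤ W t x) →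
      ∀ t ∈ Icc 0 τ, ∀ x, -(m / 2) ≤ W t x := by
    intro m hm hWm t ht x
    have hE : ∀ t, HasDerivAt (fun s : ℝ => Real.exp (-l * s)) (Real.exp (-l * t) * (-l)) t := by
      intro t
      have := ((hasDerivAt_id t).const_mul (-l)).exp
      simpa using this
    refine aux_barrier (fun s => W s x)
      (fun t => Real.exp (-l * t) * (-l) * w t x + Real.exp (-l * t) * wt t x) τ (m / 2)
      (by linarith) ?_ ?_ ?_ ?_ t ht
    · exact (by fun_prop : Continuous fun s : ℝ => Real.exp (-l * s)).continuousOn.mul (hcont x)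
    · simpa [hW] using h0 x
    · intro t ht
      exact (hE t).mul (hd x t ht)
    · intro t ht hlt
      have htI : t ∈ Icc 0 τ := Ioo_subset_Icc_self ht
      have he := Real.exp_pos (-l * t)
      have hneg : w t x < 0 := by
        by_contra hcon
        push Not at hcon
        have : 0 ≤ W t x := mul_nonneg he.le hcon
        try simp only at hlt
        linarith
      have h1 := hineq t ht x hneg
      have h2 : -m ≤ Real.exp (-l * t) * ∫ y, κ (y - x) * w t y := by
        rw [← integral_const_mul, ← aux_const hκ (-m) x]
        apply integral_mono (aux_int hκ _ continuous_const x) ((aux_int hκ _ (hx t htI) x).const_mul _)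
        intro y
        have h3 := mul_le_mul_of_nonneg_left (hWm t htI y) (hκ.2.1 (y - x))
        simp only [hW] at h3 ⊢
        linarith
      have h4 := mul_le_mul_of_nonneg_left h1 he.le
      simp only [hW] at hlt
      have h5 : (C - l) * (Real.exp (-l * t) * w t x) ≥ -2 * (Real.exp (-l * t) * w t x) := by
        apply mul_le_mul_of_nonpos_right hCl
        linarith
      nlinarith
  have hit : ∀ n : ℕ, ∀ t ∈ Icc 0 τ, ∀ x, -(|B| * (1 / 2) ^ n) ≤ W t x := by
    intro n
    induction n with
    | zero =>
      intro t ht x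
      have h1 := hB t ht x
      have h2 : Real.exp (-l * t) ≤ 1 := Real.exp_le_one_iff.mpr (by nlinarith [ht.1])
      have h3 : |W t x| ≤ |B| := by
        simp only [hW, abs_mul, Real.abs_exp]
        have := le_abs_self B
        have := abs_nonneg (w t x)
        have := Real.exp_pos (-l * t)
        nlinarith
      have := (abs_le.mp h3).1
      simpa using this
    | succ n ih =>
      intro t ht x
      have := step _ (by positivity) ih t ht x
      rw [pow_succ]
      linarith
  intro t ht x
  have hlim : Tendsto (fun n : ℕ => -(|B| * (1 / 2 : ℝ) ^ n)) atTop (nhds 0) := by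
    have := ((tendsto_pow_atTop_nhds_zero_of_lt_one (r := (1/2 : ℝ)) (by norm_num) (by norm_num)).const_mul |B|).neg
    simpa using this
  have hWp : 0 ≤ W t x := le_of_tendsto' hlim (fun n => hit n t ht x)
  exact nonneg_of_mul_nonneg_right hWp (Real.exp_pos _)

lemma aux_diff {N : ℕ} {T M₀ : ℝ} {f : ℝ → Euc N → ℝ → ℝ} (hf : SatH0 T M₀ f) (t : ℝ) (x : Euc N) :
    Differentiable ℝ (fun v => f t x v) := by
  have h := (hf.2.1 x).differentiable (by norm_num)
  exact h.comp (g := fun p : ℝ × ℝ => f p.1 x p.2) (f := fun v : ℝ => (t, v)) (by fun_prop)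

lemma aux_lip {N : ℕ} {T M₀ : ℝ} {f : ℝ → Euc N → ℝ → ℝ} (hf : SatH0 T M₀ f) (R : ℝ) (hR : 0 < R) :
    ∃ L : ℝ, 0 ≤ L ∧ ∀ t x a b, |a| ≤ R → |b| ≤ R →
      |a * f t x a - b * f t x b| ≤ L * |a - b| := by
  obtain ⟨C, hC⟩ := (hf.2.2.1 R hR).1
  refine ⟨|C| + R * |C|, by positivity, ?_⟩
  intro t x a b ha hb
  have hdiff := aux_diff hf t x
  have hder : ∀ v ∈ Icc (-R) R, HasDerivWithinAt (fun v => v * f t x v)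
      (1 * f t x v + v * deriv (fun v => f t x v) v) (Icc (-R) R) v := fun v _ =>
    ((hasDerivAt_id v).mul (hdiff v).hasDerivAt).hasDerivWithinAt
  have hbd : ∀ v ∈ Icc (-R) R, ‖1 * f t x v + v * deriv (fun v => f t x v) v‖ ≤ |C| + R * |C| := by
    intro v hv
    have hv' : |v| ≤ R := abs_le.mpr hv
    have h := hC t x v hv'
    have h1 := abs_nonneg (f t x v)
    have h2 := abs_nonneg (deriv (fun s => f s x v) t)
    have h3 := abs_nonneg (deriv (fun v => f t x v) v)
    have h4 := le_abs_self C
    rw [Real.norm_eq_abs, one_mul]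
    refine (abs_add_le _ _).trans ?_
    rw [abs_mul]
    have := mul_le_mul hv' (show |deriv (fun v => f t x v) v| ≤ |C| by linarith) h3 hR.le
    linarith
  have := (convex_Icc (-R) R).norm_image_sub_le_of_norm_hasDerivWithin_le hder hbd
    (abs_le.mp hb) (abs_le.mp ha)
  simpa [Real.norm_eq_abs] using this

lemma aux_conv {N : ℕ} {κ : Euc N → ℝ} (hκ : KernelHyp κ) (u v : Euc N → ℝ) (hu : Continuous u)
    (hv : Continuous v) (a b : ℝ) (x : Euc N) :
    ∫ y, κ (y - x) * (a * u y - b * v y) =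
      a * (∫ y, κ (y - x) * u y) - b * ∫ y, κ (y - x) * v y := by
  rw [← integral_const_mul, ← integral_const_mul, ← integral_sub
    ((aux_int hκ u hu x).const_mul a) ((aux_int hκ v hv x).const_mul b)]
  congr 1
  ext y
  ring

lemma aux_tcont {N : ℕ} {κ : Euc N → ℝ} {f : ℝ → Euc N → ℝ → ℝ} {u : ℝ → Euc N → ℝ} {I : Set ℝ}
    (hu : IsSol κ f u I) (x : Euc N) : ContinuousOn (fun t => u t x) I :=
  hu.1.comp (f := fun t : ℝ => (t, x)) (by fun_prop) (fun t ht => ⟨ht, mem_univ _⟩)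

lemma aux_upper {N : ℕ} {T M₀ : ℝ} (hM₀ : 0 < M₀) {κ : Euc N → ℝ} (hκ : KernelHyp κ)
    {f : ℝ → Euc N → ℝ → ℝ} (hf : SatH0 T M₀ f) {τ M : ℝ} {u : ℝ → Euc N → ℝ}
    (hu : IsSol κ f u (Icc 0 τ)) (h0 : ∀ x, u 0 x ≤ M) :
    ∀ t ∈ Icc 0 τ, ∀ x, u t x ≤ max M M₀ := by
  obtain ⟨B, hB⟩ := hu.2.2.1 (Icc 0 τ) le_rfl isCompact_Icc
  have key := aux_comp hκ (fun t x => max M M₀ * 1 - 1 * u t x) (fun t x => - RHS κ f u t x) τ 0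
    (|max M M₀| + B) (fun x => (continuousOn_const).sub ((aux_tcont hu x).const_mul 1 |> fun h => h))
    (fun t ht => continuous_const.sub (continuous_const.mul (hu.2.1 t ht).1.continuous)) ?_ ?_ ?_ ?_
  · intro t ht x
    have := key t ht x
    try simp only at this
    linarith
  · intro t ht x
    have h1 := hB t ht x
    have := abs_sub (max M M₀) (u t x)
    simp only [mul_one, one_mul]
    linarith
  · intro x t ht
    have h := hu.2.2.2 x t (by rwa [interior_Icc])
    simpa using h.const_sub (max M M₀)
  · intro x
    have := h0 x
    have := le_max_left M M₀
    try simp only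
    linarith
  · intro t ht x hneg
    have hc := (hu.2.1 t (Ioo_subset_Icc_self ht)).1.continuous
    try simp only at hneg ⊢
    rw [aux_conv hκ (fun _ => 1) (u t) continuous_const hc, aux_const hκ]
    unfold RHS
    have h1 := le_max_right M M₀
    have h2 : M₀ ≤ u t x := by linarith
    have h3 := hf.2.2.2.1 t x _ h2
    nlinarith

lemma aux_lower {N : ℕ} {T M₀ : ℝ} {κ : Euc N → ℝ} (hκ : KernelHyp κ)
    {f : ℝ → Euc N → ℝ → ℝ} (hf : SatH0 T M₀ f) {τ ε l : ℝ} (hε : 0 < ε) (hl : 0 ≤ l)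
    (hfl : ∀ t x z, |z| ≤ ε → -l ≤ f t x z) {u : ℝ → Euc N → ℝ}
    (hu : IsSol κ f u (Icc 0 τ)) (h0 : ∀ x, ε ≤ u 0 x) :
    ∀ t ∈ Icc 0 τ, ∀ x, ε * Real.exp (-l * t) ≤ u t x := by
  obtain ⟨B, hB⟩ := hu.2.2.1 (Icc 0 τ) le_rfl isCompact_Icc
  obtain ⟨L, hL0, hL⟩ := aux_lip hf (|B| + ε) (by positivity)
  have hz : ∀ t, 0 ≤ t → 0 < ε * Real.exp (-l * t) ∧ ε * Real.exp (-l * t) ≤ ε := by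
    intro t ht
    have h2 : Real.exp (-l * t) ≤ 1 := Real.exp_le_one_iff.mpr (by nlinarith)
    exact ⟨by positivity, by nlinarith⟩
  have hE : ∀ t, HasDerivAt (fun s : ℝ => ε * Real.exp (-l * s)) (ε * (Real.exp (-l * t) * (-l))) t := by
    intro t
    have := (((hasDerivAt_id t).const_mul (-l)).exp).const_mul ε
    simpa using this
  have key := aux_comp hκ (fun t x => 1 * u t x - (ε * Real.exp (-l * t)) * 1)
    (fun t x => RHS κ f u t x - ε * (Real.exp (-l * t) * (-l))) τ L
    (B + ε) ?_ ?_ ?_ ?_ ?_ ?_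
  · intro t ht x
    have := key t ht x
    try simp only at this
    linarith
  · intro x
    exact (continuousOn_const.mul (aux_tcont hu x)).sub (by fun_prop)
  · intro t ht
    exact (continuous_const.mul (hu.2.1 t ht).1.continuous).sub continuous_const
  · intro t ht x
    have h1 := hB t ht x
    have h2 := hz t ht.1
    have := abs_sub (u t x) (ε * Real.exp (-l * t))
    rw [abs_of_pos h2.1] at this
    simp only [mul_one, one_mul]
    linarith
  · intro x t ht
    have h := hu.2.2.2 x t (by rwa [interior_Icc])
    simp only [one_mul, mul_one]
    exact h.sub (hE t)
  · intro x
    have := h0 x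
    simp
    linarith
  · intro t ht x hneg
    have htI := Ioo_subset_Icc_self ht
    have hc := (hu.2.1 t htI).1.continuous
    try simp only at hneg ⊢
    rw [aux_conv hκ (u t) (fun _ => 1) hc continuous_const, aux_const hκ]
    unfold RHS
    have h2 := hz t ht.1.le
    set z := ε * Real.exp (-l * t) with hzdef
    have h1 := hB t htI x
    have hzabs : |z| ≤ ε := by rw [abs_of_pos h2.1]; exact h2.2
    have h3 := hL t x (u t x) z (by have := le_abs_self B; linarith) (by have := abs_nonneg B; linarith)
    have h4 := (abs_le.mp h3).1
    have h6 : |u t x - z| = -(u t x - z) := abs_of_neg (by linarith)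
    rw [h6] at h4
    have h5 := mul_le_mul_of_nonneg_left (hfl t x z hzabs) h2.1.le
    have h7 : ε * (Real.exp (-l * t) * (-l)) = z * (-l) := by rw [hzdef]; ring
    rw [h7]
    linarith

lemma aux_main {N : ℕ} {T M₀ : ℝ} {κ : Euc N → ℝ} (hκ : KernelHyp κ)
    {f : ℝ → Euc N → ℝ → ℝ} (hf : SatH0 T M₀ f) {τ m P A d s η c : ℝ} (hm : 0 < m) (hP : 0 < P)
    (hη : 0 ≤ η) (hs : 0 ≤ s) (hsd : s ≤ d - η * τ) (hA : Real.exp d ≤ A) (hc : c < 0)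
    (hfc : ∀ t x u, 0 ≤ u → u ≤ A * P → deriv (fun v => f t x v) u ≤ c)
    (hηc : η ≤ -c * (Real.exp s - 1) * m)
    {u v : ℝ → Euc N → ℝ}
    (hu : IsSol κ f u (Icc 0 τ)) (hv : IsSol κ f v (Icc 0 τ))
    (hub : ∀ t ∈ Icc 0 τ, ∀ x, m ≤ u t x ∧ u t x ≤ P)
    (hvb : ∀ t ∈ Icc 0 τ, ∀ x, m ≤ v t x ∧ v t x ≤ P)
    (h0 : ∀ x, v 0 x ≤ Real.exp d * u 0 x) :
    ∀ t ∈ Icc 0 τ, ∀ x, v t x ≤ Real.exp (d - η * t) * u t x := by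
  have hA0 : 0 < A := (Real.exp_pos d).trans_le hA
  obtain ⟨L, hL0, hL⟩ := aux_lip hf (A * P + P) (by positivity)
  have hβ : ∀ t ∈ Icc 0 τ, Real.exp s ≤ Real.exp (d - η * t) ∧ Real.exp (d - η * t) ≤ A := by
    intro t ht
    constructor
    · apply Real.exp_le_exp.mpr
      nlinarith [ht.2]
    · refine le_trans (Real.exp_le_exp.mpr ?_) hA
      nlinarith [ht.1]
  have hE : ∀ t, HasDerivAt (fun r : ℝ => Real.exp (d - η * r)) (Real.exp (d - η * t) * (-η)) t := by
    intro t
    have := (((hasDerivAt_id t).const_mul η).const_sub d).exp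
    simpa using this
  have hβu : ∀ t ∈ Icc 0 τ, ∀ x, 0 ≤ Real.exp (d - η * t) * u t x ∧
      Real.exp (d - η * t) * u t x ≤ A * P := by
    intro t ht x
    have h1 := hub t ht x
    have h2 := hβ t ht
    exact ⟨mul_nonneg (Real.exp_pos _).le (by linarith),
      mul_le_mul h2.2 h1.2 (by linarith) hA0.le⟩
  have key := aux_comp hκ (fun t x => Real.exp (d - η * t) * u t x - 1 * v t x)
    (fun t x => (Real.exp (d - η * t) * (-η)) * u t x + Real.exp (d - η * t) * RHS κ f u t x
      - RHS κ f v t x) τ L (A * P + P) ?_ ?_ ?_ ?_ ?_ ?_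
  · intro t ht x
    have := key t ht x
    try simp only at this
    linarith
  · intro x
    exact ((by fun_prop : Continuous fun t : ℝ => Real.exp (d - η * t)).continuousOn.mul
      (aux_tcont hu x)).sub (continuousOn_const.mul (aux_tcont hv x))
  · intro t ht
    exact (continuous_const.mul (hu.2.1 t ht).1.continuous).sub
      (continuous_const.mul (hv.2.1 t ht).1.continuous)
  · intro t ht x
    have h1 := hβu t ht x
    have h2 := hvb t ht x
    try simp only
    rw [abs_le]
    constructor <;> nlinarith
  · intro x t ht
    have h := hu.2.2.2 x t (by rwa [interior_Icc])
    have h' := hv.2.2.2 x t (by rwa [interior_Icc])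
    simp only [one_mul]
    exact ((hE t).mul h).sub h'
  · intro x
    have := h0 x
    simp
    linarith
  · intro t ht x hneg
    have htI := Ioo_subset_Icc_self ht
    try simp only at hneg ⊢
    rw [aux_conv hκ (u t) (v t) (hu.2.1 t htI).1.continuous (hv.2.1 t htI).1.continuous]
    unfold RHS
    have h1 := hβ t htI
    have h2 := hβu t htI x
    have h3 := hub t htI x
    have h4 := hvb t htI x
    have hes : 1 ≤ Real.exp s := Real.one_le_exp hs
    set β := Real.exp (d - η * t) with hβdef
    set a := u t x
    set b := v t x
    have hAP : 0 < A * P := by positivity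
    have h5 := hL t x (β * a) b (by rw [abs_of_nonneg h2.1]; linarith)
      (by rw [abs_of_nonneg (by linarith)]; linarith)
    have h6 : |β * a - b| = -(β * a - b) := abs_of_neg (by linarith)
    rw [h6] at h5
    have h7 := (abs_le.mp h5).1
    have hmv : f t x (β * a) - f t x a ≤ c * (β * a - a) := by
      apply (convex_Icc 0 (A * P)).image_sub_le_mul_sub_of_deriv_le (f := fun v => f t x v)
        (aux_diff hf t x).continuous.continuousOn (aux_diff hf t x).differentiableOn
      · intro z hz
        have hz' := interior_subset hz
        exact hfc t x z hz'.1 hz'.2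
      · exact ⟨by linarith, by nlinarith⟩
      · exact h2
      · nlinarith
    have h8 : η ≤ f t x a - f t x (β * a) := by
      have e1 : (Real.exp s - 1) * m ≤ (β - 1) * a :=
        mul_le_mul (by linarith) h3.1 hm.le (by linarith)
      have e2 := mul_le_mul_of_nonneg_left e1 (show 0 ≤ -c by linarith)
      nlinarith
    have h9 := mul_le_mul_of_nonneg_left h8 h2.1
    nlinarith

lemma aux_part {N : ℕ} {u v : Euc N → ℝ} {ε M : ℝ} (hε : 0 < ε) (hεM : ε < M)
    (hu : ∀ x, ε ≤ u x ∧ u x ≤ M) (hv : ∀ x, ε ≤ v x ∧ v x ≤ M) :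
    Real.exp (PartMetric u v) ≤ M / ε ∧ (∀ x, v x ≤ Real.exp (PartMetric u v) * u x) ∧
      (∀ x, u x ≤ Real.exp (PartMetric u v) * v x) := by
  have hMε : 1 ≤ M / ε := by rw [le_div_iff₀ hε]; linarith
  have hM : 0 < M := hε.trans hεM
  have hmem : M / ε ∈ {α : ℝ | 1 ≤ α ∧ ∀ x, u x / α ≤ v x ∧ v x ≤ α * u x} := by
    refine ⟨hMε, fun x => ⟨?_, ?_⟩⟩
    · rw [div_le_iff₀ (by linarith)]
      have : ε * (M / ε) = M := by field_simp
      nlinarith [hu x, hv x]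
    · have : M / ε * ε = M := by field_simp
      nlinarith [hu x, hv x]
  have hbdd : BddBelow (Real.log '' {α : ℝ | 1 ≤ α ∧ ∀ x, u x / α ≤ v x ∧ v x ≤ α * u x}) := by
    refine ⟨0, ?_⟩
    rintro _ ⟨α, hα, rfl⟩
    exact Real.log_nonneg hα.1
  have hne : (Real.log '' {α : ℝ | 1 ≤ α ∧ ∀ x, u x / α ≤ v x ∧ v x ≤ α * u x}).Nonempty :=
    ⟨_, mem_image_of_mem _ hmem⟩
  have happ : ∀ γ > PartMetric u v, ∀ x, v x ≤ Real.exp γ * u x ∧ u x ≤ Real.exp γ * v x := by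
    intro γ hγ x
    obtain ⟨_, ⟨α, hα, rfl⟩, hlt⟩ := exists_lt_of_csInf_lt hne hγ
    have hα0 : 0 < α := by linarith [hα.1]
    have hle : α ≤ Real.exp γ := by
      rw [← Real.log_le_iff_le_exp hα0]; exact hlt.le
    have h1 := hα.2 x
    rw [div_le_iff₀ hα0] at h1
    constructor <;> nlinarith [hu x, hv x]
  have hlim : ∀ c : ℝ, Tendsto (fun γ => Real.exp γ * c) (nhdsWithin (PartMetric u v) (Ioi (PartMetric u v)))
      (nhds (Real.exp (PartMetric u v) * c)) := fun c =>
    ((by fun_prop : Continuous fun γ : ℝ => Real.exp γ * c).tendsto _).mono_left nhdsWithin_le_nhds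
  refine ⟨?_, ?_, ?_⟩
  · rw [← Real.le_log_iff_exp_le (by positivity)]
    exact csInf_le hbdd (mem_image_of_mem _ hmem)
  · intro x
    exact ge_of_tendsto (hlim _) (eventually_nhdsWithin_of_forall fun γ hγ => (happ γ hγ x).1)
  · intro x
    exact ge_of_tendsto (hlim _) (eventually_nhdsWithin_of_forall fun γ hγ => (happ γ hγ x).2)

/-- strict decrease of the part metric. -/
theorem stmt8 {N : ℕ} (hN : 1 ≤ N) (T M₀ : ℝ) (hT : 0 < T) (hM₀ : 0 < M₀)
    (κ : Euc N → ℝ) (hκ : KernelHyp κ)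
    (f : ℝ → Euc N → ℝ → ℝ) (hf : SatH0 T M₀ f)
    (ε σ M τ : ℝ) (hε : 0 < ε) (hσ : 0 < σ) (hM : 0 < M) (hτ : 0 < τ)
    (hεM : ε < M) (hσlog : σ ≤ Real.log (M / ε)) :
    ∃ δ > 0, ∀ u v : ℝ → Euc N → ℝ,
      IsSol κ f u (Set.Icc 0 τ) → IsSol κ f v (Set.Icc 0 τ) →
      (∀ x, ε ≤ u 0 x ∧ u 0 x ≤ M) → (∀ x, ε ≤ v 0 x ∧ v 0 x ≤ M) →
      σ ≤ PartMetric (u 0) (v 0) →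
      (∃ δ' > 0, ∀ x, δ' ≤ u τ x) ∧ (∃ δ' > 0, ∀ x, δ' ≤ v τ x) ∧
      PartMetric (u τ) (v τ) ≤ PartMetric (u 0) (v 0) - δ := by
  set P := max M M₀ with hP
  have hP0 : 0 < P := lt_max_of_lt_left hM
  obtain ⟨C, hC⟩ := (hf.2.2.1 ε hε).1
  set l := |C| with hl
  have hl0 : 0 ≤ l := abs_nonneg C
  have hfl : ∀ t x z, |z| ≤ ε → -l ≤ f t x z := by
    intro t x z hz
    have h := hC t x z hz
    have h1 := neg_abs_le (f t x z)
    have h2 := abs_nonneg (deriv (fun s => f s x z) t)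
    have h3 := abs_nonneg (deriv (fun v => f t x v) z)
    have h4 := le_abs_self C
    linarith
  set m := ε * Real.exp (-l * τ) with hmdef
  have hm : 0 < m := by positivity
  have hA0 : 0 < M / ε := by positivity
  obtain ⟨c, hc, hfc⟩ := hf.2.2.2.2 0 (M / ε * P) le_rfl (by positivity)
  have hes : 1 < Real.exp (σ / 2) := by rw [Real.one_lt_exp_iff]; linarith
  set η := min (σ / (2 * τ)) (-c * (Real.exp (σ / 2) - 1) * m) with hη
  have hη0 : 0 < η := by
    apply lt_min (by positivity)
    exact mul_pos (mul_pos (by linarith) (by linarith)) hm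
  have hητ : η * τ ≤ σ / 2 := by
    calc η * τ ≤ σ / (2 * τ) * τ := mul_le_mul_of_nonneg_right (min_le_left _ _) hτ.le
      _ = σ / 2 := by field_simp
  refine ⟨η * τ, by positivity, ?_⟩
  intro u v hu hv hu0 hv0 hd
  have bnd : ∀ w : ℝ → Euc N → ℝ, IsSol κ f w (Set.Icc 0 τ) → (∀ x, ε ≤ w 0 x ∧ w 0 x ≤ M) →
      ∀ t ∈ Icc 0 τ, ∀ x, m ≤ w t x ∧ w t x ≤ P := by
    intro w hw hw0 t ht x
    refine ⟨le_trans ?_ (aux_lower hκ hf hε hl0 hfl hw (fun x => (hw0 x).1) t ht x),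
      aux_upper hM₀ hκ hf hw (fun x => (hw0 x).2) t ht x⟩
    apply mul_le_mul_of_nonneg_left _ hε.le
    apply Real.exp_le_exp.mpr
    nlinarith [ht.2]
  have hub := bnd u hu hu0
  have hvb := bnd v hv hv0
  obtain ⟨hA, hvu, huv⟩ := aux_part hε hεM hu0 hv0
  set d := PartMetric (u 0) (v 0) with hddef
  have hτI : τ ∈ Icc 0 τ := ⟨hτ.le, le_rfl⟩
  have k1 := aux_main hκ hf (d := d) (s := σ / 2) (η := η) hm hP0 hη0.le (by linarith)
    (by linarith) hA hc hfc (min_le_right _ _) hu hv hub hvb hvu τ hτI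
  have k2 := aux_main hκ hf (d := d) (s := σ / 2) (η := η) hm hP0 hη0.le (by linarith)
    (by linarith) hA hc hfc (min_le_right _ _) hv hu hvb hub huv τ hτI
  refine ⟨⟨m, hm, fun x => (hub τ hτI x).1⟩, ⟨m, hm, fun x => (hvb τ hτI x).1⟩, ?_⟩
  unfold PartMetric
  apply csInf_le
  · refine ⟨0, ?_⟩
    rintro _ ⟨α, hα, rfl⟩
    exact Real.log_nonneg hα.1
  · refine ⟨Real.exp (d - η * τ), ⟨Real.one_le_exp (by linarith), fun x => ⟨?_, k1 x⟩⟩, Real.log_exp _⟩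
    rw [div_le_iff₀ (Real.exp_pos _), mul_comm]
    exact k2 x

end
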